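/- Let W ≥ 1 agents be indexed by a ∈ Fin W with quadratic utilities U_a(P) = ρ_a P + (β_a/2) P² where β_a < 0 (so each −U_a is strictly convex), and constraint intervals X_a = [lo_a, hi_a] ⊆ ℝ (lo_a ≤ hi_a) with X = ∩_a X_a nonempty. Let α_k > 0 satisfy ∑_k α_k = ∞ and ∑_k α_k² < ∞, and define the iterates by P_a(0) ∈ X_a and P_a(k+1) = Π_{X_a}[ (1/W) ∑_b P_b(k) − α_k (−U_a)'(P_a(k)) ], where Π_{X_a} is the Euclidean projection (clamp) onto [lo_a, hi_a]. Then the maximizer P* of ∑_a U_a over X exists and is unique, and lim_{k→∞} P_a(k) = P* for every agent a. -/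

import Mathlib

open Filter

/-- A nonnegative sequence with `V (k+1) ≤ (1 - c α k) V k + C (α k)²` tends to zero for
square-summable, non-summable positive stepsizes. -/
theorem tendsto_zero_of_contraction_add_sq {V α : ℕ → ℝ} {c C : ℝ} (hc : 0 < c)
    (hα : ∀ k, 0 < α k) (hdiv : ¬ Summable α) (hsq : Summable (fun k => α k ^ 2))
    (hV : ∀ k, 0 ≤ V k) (hC : 0 ≤ C)
    (h : ∀ k, V (k + 1) ≤ (1 - c * α k) * V k + C * α k ^ 2) :
    Tendsto V atTop (nhds 0) := by
  set A : ℕ → ℝ := fun n => ∑ j ∈ Finset.range n, α j ^ 2 with hA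
  have hA_le (n : ℕ) : A n ≤ ∑' j, α j ^ 2 := hsq.sum_le_tsum _ fun j _ => sq_nonneg _
  have hA_succ (n : ℕ) : A (n + 1) = A n + α n ^ 2 := Finset.sum_range_succ _ _
  have hAC (n : ℕ) : C * A n ≤ C * ∑' j, α j ^ 2 := mul_le_mul_of_nonneg_left (hA_le n) hC
  have h_anti : Antitone fun n => V n - C * A n := by
    refine antitone_nat_of_succ_le fun n => ?_
    have := mul_nonneg (mul_pos hc (hα n)).le (hV n)
    rw [hA_succ]
    linarith [h n]
  have h_bdd : BddBelow (Set.range fun n => V n - C * A n) := by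
    refine ⟨-(C * ∑' j, α j ^ 2), ?_⟩
    rintro _ ⟨n, rfl⟩
    simp only
    linarith [hV n, hAC n]
  have h_lim := (tendsto_atTop_ciInf h_anti h_bdd).add (hsq.hasSum.tendsto_sum_nat.const_mul C)
  simp only [hA, sub_add_cancel] at h_lim
  set v : ℝ := (⨅ n, (V n - C * A n)) + C * ∑' j, α j ^ 2
  have hv0 : 0 ≤ v := ge_of_tendsto' h_lim hV
  rcases hv0.eq_or_lt with hv0 | hv0
  · rw [hv0]
    exact h_lim
  exfalso
  have h_sum : Summable fun k => c * α k * V k := by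
    refine summable_of_sum_range_le (c := V 0 + C * ∑' j, α j ^ 2)
      (fun n => mul_nonneg (mul_pos hc (hα n)).le (hV n)) fun n => ?_
    have key : ∑ k ∈ Finset.range n, c * α k * V k ≤ V 0 - V n + C * A n := by
      induction n with
      | zero => simp [hA]
      | succ n ih =>
        rw [Finset.sum_range_succ, hA_succ]
        linarith [h n]
    linarith [hV n, hAC n]
  obtain ⟨N, hN⟩ := eventually_atTop.1 (h_lim.eventually (lt_mem_nhds (half_lt_self hv0)))
  apply hdiv
  rw [← summable_nat_add_iff N]
  have h_tail := ((summable_nat_add_iff N).2 h_sum).mul_left (c * (v / 2))⁻¹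
  refine Summable.of_nonneg_of_le (fun k => (hα _).le) (fun k => ?_) h_tail
  rw [le_inv_mul_iff₀ (by positivity)]
  have := mul_le_mul_of_nonneg_left (hN (k + N) (by omega)).le (mul_pos hc (hα (k + N))).le
  linarith

/-- Clamping to an interval does not increase the distance to a point of that interval. -/
theorem sq_clamp_sub_le {l u z x : ℝ} (hx : x ∈ Set.Icc l u) :
    (min (max z l) u - x) ^ 2 ≤ (z - x) ^ 2 := by
  obtain ⟨h₁, h₂⟩ := hx
  rcases max_cases z l with ⟨e, h⟩ | ⟨e, h⟩ <;> rw [e]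
  · rcases min_cases z u with ⟨e, h'⟩ | ⟨e, h'⟩ <;> rw [e]
    nlinarith
  · rw [min_eq_left (h₁.trans h₂)]
    nlinarith

/-- Variational inequality characterizing the projection onto an interval. -/
theorem clamp_variational {l u z y : ℝ} (hy : y ∈ Set.Icc l u) :
    (z - min (max z l) u) * (y - min (max z l) u) ≤ 0 := by
  obtain ⟨h₁, h₂⟩ := hy
  rcases max_cases z l with ⟨e, h⟩ | ⟨e, h⟩ <;> rw [e]
  · rcases min_cases z u with ⟨e, h'⟩ | ⟨e, h'⟩ <;> rw [e]
    · simp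
    · nlinarith
  · rw [min_eq_left (h₁.trans h₂)]
    nlinarith

theorem clamp_mem_Icc {l u : ℝ} (h : l ≤ u) (z : ℝ) : min (max z l) u ∈ Set.Icc l u :=
  ⟨le_min (le_max_right _ _) h, min_le_right _ _⟩

/-- The squared distance from `m` to an intersection of intervals is bounded by the sum of the
squared distances from `m` to points chosen in each of the intervals. -/
theorem exists_mem_iInter_Icc_sq_sub_le {ι : Type*} [Fintype ι] [Nonempty ι] {lo hi p : ι → ℝ}
    (hne : (⋂ a, Set.Icc (lo a) (hi a)).Nonempty) (hp : ∀ a, p a ∈ Set.Icc (lo a) (hi a))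
    (m : ℝ) : ∃ y ∈ ⋂ a, Set.Icc (lo a) (hi a), (m - y) ^ 2 ≤ ∑ a, (p a - m) ^ 2 := by
  obtain ⟨x, hx⟩ := hne
  rw [Set.mem_iInter] at hx
  have h_single (a : ι) : (p a - m) ^ 2 ≤ ∑ a, (p a - m) ^ 2 :=
    Finset.single_le_sum (f := fun a => (p a - m) ^ 2) (fun _ _ => sq_nonneg _)
      (Finset.mem_univ a)
  obtain ⟨i, hi_max⟩ := Finite.exists_max lo
  obtain ⟨j, hj_min⟩ := Finite.exists_min hi
  by_cases h₁ : m < lo i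
  · refine ⟨lo i, Set.mem_iInter.2 fun a => ⟨hi_max a, (hx i).1.trans (hx a).2⟩, ?_⟩
    refine le_trans ?_ (h_single i)
    nlinarith [(hp i).1]
  by_cases h₂ : hi j < m
  · refine ⟨hi j, Set.mem_iInter.2 fun a => ⟨(hx a).1.trans (hx j).2, hj_min a⟩, ?_⟩
    refine le_trans ?_ (h_single j)
    nlinarith [(hp j).2]
  push Not at h₁ h₂
  refine ⟨m, Set.mem_iInter.2 fun a => ⟨(hi_max a).trans h₁, h₂.trans (hj_min a)⟩, ?_⟩
  rw [sub_self, zero_pow two_ne_zero]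
  exact Finset.sum_nonneg fun _ _ => sq_nonneg _

theorem iInter_Icc_eq_Icc {ι : Type*} [Finite ι] [Nonempty ι] (lo hi : ι → ℝ) :
    ∃ l u, ⋂ a, Set.Icc (lo a) (hi a) = Set.Icc l u := by
  obtain ⟨i, hi_max⟩ := Finite.exists_max lo
  obtain ⟨j, hj_min⟩ := Finite.exists_min hi
  refine ⟨lo i, hi j, Set.ext fun y => ?_⟩
  rw [Set.mem_iInter]
  exact ⟨fun h => ⟨(h i).1, (h j).2⟩,
    fun h a => ⟨(hi_max a).trans h.1, h.2.trans (hj_min a)⟩⟩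

/-- Sum of squared deviations from `x`, split at the mean `m`. -/
theorem sum_sq_sub_eq_add_card_mul {ι : Type*} [Fintype ι] {p : ι → ℝ} {m : ℝ}
    (hm : ∑ a, p a = Fintype.card ι * m) (x : ℝ) :
    ∑ a, (p a - x) ^ 2 = ∑ a, (p a - m) ^ 2 + Fintype.card ι * (m - x) ^ 2 := by
  have h (a : ι) : (p a - x) ^ 2 = (p a - m) ^ 2 + 2 * (m - x) * p a
      + ((m - x) ^ 2 - 2 * (m - x) * m) := by ring
  simp only [h, Finset.sum_add_distrib, ← Finset.mul_sum, hm, Finset.sum_const,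
    Finset.card_univ, nsmul_eq_mul]
  ring

/-- One step of averaging, gradient descent with step `t` and projection, measured by the sum of
squared distances to a point `x` satisfying the first-order optimality condition. -/
theorem projected_consensus_step_le {ι : Type*} [Fintype ι] [Nonempty ι]
    {ρ β lo hi p q : ι → ℝ} {c t m x G : ℝ} (hβ : ∀ a, c ≤ -β a) (ht : 0 < t)
    (hm : ∑ a, p a = Fintype.card ι * m)
    (hx : x ∈ ⋂ a, Set.Icc (lo a) (hi a)) (hp : ∀ a, p a ∈ Set.Icc (lo a) (hi a))
    (hopt : ∀ y ∈ ⋂ a, Set.Icc (lo a) (hi a), 0 ≤ (∑ a, (-ρ a - β a * x)) * (y - x))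
    (hG : ∑ a, (-ρ a - β a * p a) ^ 2 ≤ G)
    (hq : ∀ a, q a = min (max (m - t * (-ρ a - β a * p a)) (lo a)) (hi a)) :
    ∑ a, (q a - x) ^ 2 ≤ (1 - 2 * c * t) * ∑ a, (p a - x) ^ 2
      + (3 * G + 2 * (1 + Fintype.card ι) * ∑ a, (-ρ a - β a * x) ^ 2) * t ^ 2 := by
  obtain ⟨y, hyX, hy⟩ := exists_mem_iInter_Icc_sq_sub_le ⟨x, hx⟩ hp m
  have hn : (0 : ℝ) < 1 + Fintype.card ι := by positivity
  set n : ℝ := (Fintype.card ι : ℝ) with hn_def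
  have hn0 : 0 ≤ n := Nat.cast_nonneg _
  have hS_x := sum_sq_sub_eq_add_card_mul hm x
  have hS_y := sum_sq_sub_eq_add_card_mul hm y
  rw [← hn_def] at hS_x hS_y
  have hS_y' : (∑ a, (p a - y) ^ 2) / (1 + n) ≤ ∑ a, (p a - m) ^ 2 := by
    rw [div_le_iff₀ hn, hS_y]
    nlinarith [mul_le_mul_of_nonneg_left hy hn0]
  have hterm (a : ι) : (q a - x) ^ 2 ≤ (m - x) ^ 2 + (1 / 2) * (p a - m) ^ 2
      + (1 / 2) * ((p a - y) ^ 2 / (1 + n)) - 2 * t * (y - x) * (-ρ a - β a * x)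
      - 2 * c * t * (p a - x) ^ 2 + 3 * t ^ 2 * (-ρ a - β a * p a) ^ 2
      + 2 * (1 + n) * t ^ 2 * (-ρ a - β a * x) ^ 2 := by
    have h₁ := sq_clamp_sub_le (z := m - t * (-ρ a - β a * p a)) (Set.mem_iInter.1 hx a)
    rw [← hq] at h₁
    have h₂ : 0 ≤ (1 / 2) * ((p a - m) - 2 * t * (-ρ a - β a * p a)) ^ 2 := by positivity
    have h₃ : 0 ≤ (1 / 2) * ((p a - y) + 2 * (1 + n) * t * (-ρ a - β a * x)) ^ 2 / (1 + n) := by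
      positivity
    have h₃' : (1 / 2) * ((p a - y) + 2 * (1 + n) * t * (-ρ a - β a * x)) ^ 2 / (1 + n)
        = (1 / 2) * ((p a - y) ^ 2 / (1 + n)) + 2 * t * (p a - y) * (-ρ a - β a * x)
          + 2 * (1 + n) * t ^ 2 * (-ρ a - β a * x) ^ 2 := by
      field_simp
      ring
    rw [h₃'] at h₃
    have h₄ : 0 ≤ (-β a - c) * (2 * t * (p a - x) ^ 2) :=
      mul_nonneg (sub_nonneg.2 (hβ a)) (by positivity)
    linear_combination h₁ + h₂ + h₃ + h₄
  have hsum := Finset.sum_le_sum fun a (_ : a ∈ Finset.univ) => hterm a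
  simp only [Finset.sum_add_distrib, Finset.sum_sub_distrib, ← Finset.mul_sum,
    ← Finset.sum_div, Finset.sum_const, Finset.card_univ, nsmul_eq_mul] at hsum
  have h_opt := mul_nonneg (mul_pos two_pos ht).le (hopt y hyX)
  simp only [Finset.sum_sub_distrib] at h_opt
  have hGt := mul_le_mul_of_nonneg_left hG (mul_nonneg (zero_le_three (α := ℝ)) (sq_nonneg t))
  rw [← hn_def] at hsum
  linarith

/-- **Projected consensus for quadratic utilities: unique optimum and convergence.**
For `W` agents with strictly concave quadratic utilities `U a P = ρ a * P + (β a / 2) * P²`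
(`β a < 0`), interval constraints with nonempty intersection `X`, and stepsizes with
`∑ α = ∞`, `∑ α² < ∞`, the iterates
`P (k+1) a = Π_{X_a}[(1/W) ∑_b P k b - α k * (-ρ a - β a * P k a)]`
converge, for every agent, to the unique maximizer `P*` of `∑ a, U a` over `X`. -/
theorem projected_consensus_quadratic_unique_max_and_convergence
    (W : ℕ) (hW : 1 ≤ W) (ρ β : Fin W → ℝ) (hβ : ∀ a, β a < 0)
    (U : Fin W → ℝ → ℝ) (hU : ∀ a P, U a P = ρ a * P + β a / 2 * P ^ 2)
    (lo hi : Fin W → ℝ) (hlohi : ∀ a, lo a ≤ hi a)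
    (X : Set ℝ) (hX : X = ⋂ a, Set.Icc (lo a) (hi a)) (hXne : X.Nonempty)
    (α : ℕ → ℝ) (hαpos : ∀ k, 0 < α k)
    (hαdiv : ¬ Summable α) (hαsq : Summable (fun k => (α k) ^ 2))
    (P : ℕ → Fin W → ℝ)
    (hP0 : ∀ a, P 0 a ∈ Set.Icc (lo a) (hi a))
    (hupd : ∀ k a, P (k + 1) a =
      min (max ((1 / (W : ℝ)) * (∑ b, P k b) - α k * (-ρ a - β a * P k a)) (lo a))
        (hi a)) :
    ∃ Pstar ∈ X, (∀ y ∈ X, (∑ a, U a y) ≤ ∑ a, U a Pstar) ∧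
      (∀ Q ∈ X, (∀ y ∈ X, (∑ a, U a y) ≤ ∑ a, U a Q) → Q = Pstar) ∧
      ∀ a, Tendsto (fun k => P k a) atTop (nhds Pstar) := by
  have hne : Nonempty (Fin W) := ⟨⟨0, hW⟩⟩
  have hW0 : (W : ℝ) ≠ 0 := by positivity
  obtain ⟨l, u, hlu⟩ := iInter_Icc_eq_Icc lo hi
  have hXlu : X = Set.Icc l u := hX.trans hlu
  have hle : l ≤ u := Set.nonempty_Icc.1 (hXlu ▸ hXne)
  have hB : ∑ a, β a < 0 := Finset.sum_neg (fun a _ => hβ a) Finset.univ_nonempty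
  set x : ℝ := min (max (-(∑ a, ρ a) / ∑ a, β a) l) u
  have hxX : x ∈ X := hXlu ▸ clamp_mem_Icc hle _
  have hgrad : ∑ a, (-ρ a - β a * x) = (∑ a, β a) * (-(∑ a, ρ a) / (∑ a, β a) - x) := by
    rw [mul_sub, mul_div_cancel₀ _ hB.ne, Finset.sum_sub_distrib, Finset.sum_neg_distrib,
      Finset.sum_mul]
  have hopt : ∀ y ∈ X, 0 ≤ (∑ a, (-ρ a - β a * x)) * (y - x) := fun y hy => by
    rw [hgrad, mul_assoc]
    exact mul_nonneg_of_nonpos_of_nonpos hB.le (clamp_variational (hXlu ▸ hy))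
  have hUsum (y : ℝ) : ∑ a, U a y = ∑ a, U a x - (∑ a, (-ρ a - β a * x)) * (y - x)
      + (∑ a, β a) * ((y - x) ^ 2 / 2) := by
    rw [Finset.sum_mul, Finset.sum_mul, ← Finset.sum_sub_distrib, ← Finset.sum_add_distrib]
    refine Finset.sum_congr rfl fun a _ => ?_
    rw [hU, hU]
    ring
  refine ⟨x, hxX, fun y hy => ?_, fun Q hQ hmax => ?_, ?_⟩
  · nlinarith [hopt y hy, hUsum y, sq_nonneg (y - x)]
  · have h₁ : 0 ≤ (∑ a, β a) * ((Q - x) ^ 2 / 2) := by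
      linarith [hopt Q hQ, hUsum Q, hmax x hxX]
    have h₂ : (Q - x) ^ 2 ≤ 0 := by nlinarith
    exact sub_eq_zero.1 (pow_eq_zero_iff two_ne_zero |>.1 (h₂.antisymm (sq_nonneg _)))
  have hP (k : ℕ) (a : Fin W) : P k a ∈ Set.Icc (lo a) (hi a) := by
    cases k with
    | zero => exact hP0 a
    | succ k => exact hupd k a ▸ clamp_mem_Icc (hlohi a) _
  have hG (a : Fin W) : ∃ G, ∀ p ∈ Set.Icc (lo a) (hi a), (-ρ a - β a * p) ^ 2 ≤ G := by
    obtain ⟨G, hG⟩ := isCompact_Icc.bddAbove_image (K := Set.Icc (lo a) (hi a))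
      (f := fun p => (-ρ a - β a * p) ^ 2) (by fun_prop)
    exact ⟨G, fun p hp => hG ⟨p, hp, rfl⟩⟩
  choose G hG using hG
  obtain ⟨i, hi_max⟩ := Finite.exists_max β
  have hstep (k : ℕ) := projected_consensus_step_le (c := -β i) (G := ∑ a, G a)
    (m := (1 / (W : ℝ)) * ∑ b, P k b) (fun a => neg_le_neg (hi_max a)) (hαpos k)
    (by rw [Fintype.card_fin]; field_simp) (hX ▸ hxX) (hP k) (hX ▸ hopt)
    (Finset.sum_le_sum fun a _ => hG a _ (hP k a)) (hupd k)
  have hG0 : 0 ≤ ∑ a, G a :=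
    Finset.sum_nonneg fun a _ => (sq_nonneg _).trans (hG a _ (hP 0 a))
  have hV : Tendsto (fun k => ∑ a, (P k a - x) ^ 2) atTop (nhds 0) :=
    tendsto_zero_of_contraction_add_sq (c := 2 * -β i) (by linarith [hβ i]) hαpos hαdiv hαsq
      (fun k => Finset.sum_nonneg fun a _ => sq_nonneg _)
      (add_nonneg (by positivity) (mul_nonneg (by positivity)
        (Finset.sum_nonneg fun a _ => sq_nonneg _))) hstep
  intro a
  have hsq : Tendsto (fun k => (P k a - x) ^ 2) atTop (nhds 0) :=
    squeeze_zero (fun _ => sq_nonneg _) (fun k => Finset.single_le_sum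
      (f := fun a => (P k a - x) ^ 2) (fun _ _ => sq_nonneg _) (Finset.mem_univ a)) hV
  have habs := hsq.sqrt
  simp only [Real.sqrt_sq_eq_abs, Real.sqrt_zero] at habs
  exact tendsto_sub_nhds_zero_iff.1 ((tendsto_zero_iff_abs_tendsto_zero _).2 habs)
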